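/- arXiv:2310.02325 — 2 statements merged into one kernel-verified Lean document; each statement's English description precedes it below -/
import Mathlib

section
/- Let g ≥ 2 and b ≥ 1 be integers, let Δ be a nonnegative integer, let T be a real number, and let μ = (m_1, …, m_ℓ) be a finite list of positive integers with m_1 + ⋯ + m_ℓ = 2g − 2. Set κ_μ = (1/12) Σ_{i=1}^ℓ m_i(m_i+2)/(m_i+1) and χ = 2 − 2b − Δ. If ((g−1)/2)·Δ < T, then −6κ_μ·χ < 3T + 4(g−1)(b−1). -/
/-- The sum `Σ m(m+2)/(m+1)` over a list of positive integers is at most `3/2` times its sum. -/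
theorem sum_map_mul_add_two_div_le (μ : List ℕ) (hpos : ∀ m ∈ μ, 0 < m) :
    (μ.map (fun m : ℕ => (m * (m + 2) : ℝ) / (m + 1))).sum ≤ 3 / 2 * (μ.sum : ℝ) := by
  induction μ with
  | nil => simp
  | cons m μ ih =>
    have hm : (1 : ℝ) ≤ m := by exact_mod_cast hpos m List.mem_cons_self
    have hterm : (m * (m + 2) : ℝ) / (m + 1) ≤ 3 / 2 * m := by
      rw [div_le_iff₀ (by positivity)]
      nlinarith
    have htail := ih fun k hk => hpos k (List.mem_cons_of_mem m hk)
    simp only [List.map_cons, List.sum_cons, Nat.cast_add]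
    linarith


/-- If `g ≥ 2`, `b ≥ 1`, `Δ` is a nonnegative integer, `T` real, `μ` a partition of
`2g - 2` into positive integers, `κ_μ = (1/12) Σ m_i(m_i+2)/(m_i+1)`, `χ = 2 - 2b - Δ`,
and `((g-1)/2)·Δ < T`, then `-6 κ_μ χ < 3T + 4(g-1)(b-1)`. -/
theorem stmt1 (g b : ℤ) (hg : 2 ≤ g) (hb : 1 ≤ b) (Δ : ℕ) (T : ℝ)
    (μ : List ℕ) (hpos : ∀ m ∈ μ, 0 < m) (hsum : (μ.sum : ℤ) = 2 * g - 2)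
    (κ : ℝ) (hκ : κ = (1 / 12) * (μ.map (fun m => (m * (m + 2) : ℝ) / (m + 1))).sum)
    (χ : ℝ) (hχ : χ = 2 - 2 * (b : ℝ) - (Δ : ℝ))
    (hT : (((g : ℝ) - 1) / 2) * (Δ : ℝ) < T) :
    -6 * κ * χ < 3 * T + 4 * ((g : ℝ) - 1) * ((b : ℝ) - 1) := by
  have hsum' : (μ.sum : ℝ) = 2 * g - 2 := by
    have h := congrArg (Int.cast : ℤ → ℝ) hsum
    rwa [Int.cast_natCast, Int.cast_sub, Int.cast_mul, Int.cast_ofNat] at h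
  have hg' : (2 : ℝ) ≤ g := by exact_mod_cast hg
  have hb' : (1 : ℝ) ≤ b := by exact_mod_cast hb
  have hκ_le : κ ≤ ((g : ℝ) - 1) / 4 := by
    have hmap : (μ >>= fun a => pure (a : ℝ)) = μ.map (fun m : ℕ => (m : ℝ)) :=
      List.map_eq_flatMap.symm
    rw [hmap, List.map_map] at hκ
    have hle := sum_map_mul_add_two_div_le μ hpos
    simp only [Function.comp_def] at hκ
    linarith
  have hχ_nonneg : 0 ≤ -χ := by
    have : (0 : ℝ) ≤ Δ := Nat.cast_nonneg Δ
    linarith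
  have hmul := mul_le_mul_of_nonneg_right hκ_le hχ_nonneg
  have hgb : 0 ≤ ((g : ℝ) - 1) * ((b : ℝ) - 1) :=
    mul_nonneg (by linarith) (by linarith)
  subst hχ
  linarith
end

section
/- Let N and Q be groups, let φ : Q → Aut(N) be a group homomorphism, and let G = N ⋊_φ Q. Let S ⊆ N be a subset and d ∈ Q. Let K be the normal closure in N of the set {φ(q)(s) : q ∈ Q, s ∈ S} (so K is a φ-invariant normal subgroup of N, and Q acts on N/K), and let D be the normal closure of d in Q. Assume that every element of D acts trivially on N/K under the induced action. Then the quotient of G by the normal closure (in G) of S ∪ {d} is isomorphic to the semidirect product (N/K) ⋊ (Q/D), where the action of Q/D on N/K is the one induced by φ. -/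
/-- Let `G = N ⋊[φ] Q`, `S ⊆ N`, `d ∈ Q`.  Let `K` be the normal closure in `N` of the
`Q`-orbit of `S` (a `φ`-invariant normal subgroup, so `Q` acts on `N/K` via an induced
action `ψ`), and let `D` be the normal closure of `d` in `Q`.  If every element of `D`
acts trivially on `N/K`, then `G` modulo the normal closure of `S ∪ {d}` is isomorphic to
`(N/K) ⋊ (Q/D)` with the induced action. -/
theorem stmt13 (N Q : Type*) [Group N] [Group Q] (φ : Q →* MulAut N)
    (S : Set N) (d : Q)
    (K : Subgroup N) [hKn : K.Normal]
    (hK : K = Subgroup.normalClosure {n | ∃ (q : Q) (s : N), s ∈ S ∧ n = φ q s})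
    (hKinv : ∀ (q : Q), ∀ n ∈ K, φ q n ∈ K)
    (ψ : Q →* MulAut (N ⧸ K))
    (hψ : ∀ (q : Q) (n : N), ψ q (QuotientGroup.mk n) = QuotientGroup.mk (φ q n))
    (D : Subgroup Q) [hDn : D.Normal]
    (hD : D = Subgroup.normalClosure {d})
    (htriv : ∀ q ∈ D, ∀ x : N ⧸ K, ψ q x = x)
    (ψbar : Q ⧸ D →* MulAut (N ⧸ K))
    (hψbar : ∀ q : Q, ψbar (QuotientGroup.mk q) = ψ q) :
    Nonempty
      (((N ⋊[φ] Q) ⧸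
          Subgroup.normalClosure
            ((SemidirectProduct.inl '' S) ∪ {SemidirectProduct.inr d})) ≃*
        ((N ⧸ K) ⋊[ψbar] (Q ⧸ D))) := by
  let F : (N ⋊[φ] Q) →* ((N ⧸ K) ⋊[ψbar] (Q ⧸ D)) :=
    SemidirectProduct.map (QuotientGroup.mk' K) (QuotientGroup.mk' D) fun q => by
      ext n
      simp [hψbar, hψ]
  have hF : Function.Surjective F := by
    rintro ⟨x, y⟩
    obtain ⟨n, rfl⟩ := QuotientGroup.mk_surjective x
    obtain ⟨q, rfl⟩ := QuotientGroup.mk_surjective y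
    exact ⟨⟨n, q⟩, rfl⟩
  have hker (g : N ⋊[φ] Q) : g ∈ F.ker ↔ g.left ∈ K ∧ g.right ∈ D := by
    rw [MonoidHom.mem_ker, SemidirectProduct.ext_iff]
    exact and_congr (QuotientGroup.eq_one_iff _) (QuotientGroup.eq_one_iff _)
  refine ⟨QuotientGroup.liftEquiv _ hF (le_antisymm ?_ fun g hg => ?_)⟩
  · refine Subgroup.normalClosure_le_normal ?_
    rintro _ (⟨s, hs, rfl⟩ | rfl)
    · have hsK : s ∈ K := hK ▸ Subgroup.subset_normalClosure ⟨1, s, hs, by simp⟩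
      exact (hker _).2 ⟨hsK, D.one_mem⟩
    · have hdD : d ∈ D := hD ▸ Subgroup.subset_normalClosure rfl
      exact (hker _).2 ⟨K.one_mem, hdD⟩
  · set R := Subgroup.normalClosure
      ((SemidirectProduct.inl '' S) ∪ {SemidirectProduct.inr d} : Set (N ⋊[φ] Q))
    have hKR : K ≤ R.comap SemidirectProduct.inl := by
      rw [hK]
      refine Subgroup.normalClosure_le_normal ?_
      rintro _ ⟨q, s, hs, rfl⟩
      have hsR : SemidirectProduct.inl s ∈ R :=
        Subgroup.subset_normalClosure (.inl ⟨s, hs, rfl⟩)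
      rw [SetLike.mem_coe, Subgroup.mem_comap, SemidirectProduct.inl_aut, map_inv]
      exact Subgroup.normalClosure_normal.conj_mem _ hsR _
    have hDR : D ≤ R.comap SemidirectProduct.inr := by
      rw [hD]
      refine Subgroup.normalClosure_le_normal ?_
      rintro _ rfl
      exact Subgroup.subset_normalClosure (.inr rfl)
    obtain ⟨hl, hr⟩ := (hker g).1 hg
    rw [← SemidirectProduct.inl_left_mul_inr_right g]
    exact R.mul_mem (hKR hl) (hDR hr)
end
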